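/- For every u in X_A one has the improved Poincaré inequality with monomial Gaussian weight: ∫_{ℝ^N_*} |∇u|² dμ_A − ∫_{ℝ^N_*} |u − ∫_{ℝ^N_*} u dμ_A|² dμ_A ≥ (1/2) ∫_{ℝ^N_*} |∇[ u − (∫_{ℝ^N_*} (u − ∫_{ℝ^N_*} u dμ_A) x dμ_A) · x ]|² dμ_A, where ∫_{ℝ^N_*} (u − ∫ u dμ_A) x dμ_A denotes the vector in ℝ^N with components ∫_{ℝ^N_*} (u − ∫ u dμ_A) x_j dμ_A. -/

import Mathlib

open MeasureTheory Real

noncomputable section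

/-- The Weyl chamber associated to the monomial weight with exponents `α`. -/
def chamber {N : ℕ} (α : Fin N → ℝ) : Set (EuclideanSpace ℝ (Fin N)) :=
  {x | ∀ i, 0 < α i → 0 < x i}

/-- The monomial weight `x^A = x₁^{α₁} ⋯ x_N^{α_N}`. -/
def monWeight {N : ℕ} (α : Fin N → ℝ) (x : EuclideanSpace ℝ (Fin N)) : ℝ :=
  ∏ i, x i ^ α i

/-- The monomial Gaussian probability measure
`dμ_A = x^A e^{-|x|²/2} dx / ∫_{ℝ^N_*} x^A e^{-|x|²/2} dx` on the Weyl chamber. -/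
def monGauss {N : ℕ} (α : Fin N → ℝ) : Measure (EuclideanSpace ℝ (Fin N)) :=
  (((MeasureTheory.volume.restrict (chamber α)).withDensity
      (fun x => ENNReal.ofReal (monWeight α x * Real.exp (-‖x‖ ^ 2 / 2)))) Set.univ)⁻¹ •
  ((MeasureTheory.volume.restrict (chamber α)).withDensity
      (fun x => ENNReal.ofReal (monWeight α x * Real.exp (-‖x‖ ^ 2 / 2))))

/-- Membership in the class `N_*`: smooth, compactly supported, with vanishing normal
component of the gradient on the boundary of the Weyl chamber. -/
def NstarClass {N : ℕ} (α : Fin N → ℝ) (u : EuclideanSpace ℝ (Fin N) → ℝ) : Prop :=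
  ContDiff ℝ (⊤ : ℕ∞) u ∧ HasCompactSupport u ∧
    ∀ x : EuclideanSpace ℝ (Fin N), ∀ i, 0 < α i → x i = 0 →
      fderiv ℝ u x (EuclideanSpace.single i 1) = 0

end

/-- Coefficients of the generalized Hermite polynomial of parameter `a` and degree `n`. -/
noncomputable def genHermiteCoeff (a : ℝ) (n : ℕ) : ℕ → ℝ
  | 0 => 1
  | k + 1 => -((n - 2 * k) * (n - 2 * k - 1 + a) / (2 * (k + 1))) * genHermiteCoeff a n k

/-- The generalized Hermite polynomial: the monic polynomial of degree `n` that is an eigenfunction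
of `f ↦ f'' + (a / x - x) f'` (for `a = 0`, or for even `n`). -/
noncomputable def genHermite (a : ℝ) (n : ℕ) : Polynomial ℝ :=
  ∑ k ∈ Finset.range (n / 2 + 1),
    Polynomial.C (genHermiteCoeff a n k) * Polynomial.X ^ (n - 2 * k)

open Polynomial in
lemma ode_monomial (a c b : ℝ) (m : ℕ) :
    X * derivative (derivative (C c * X ^ m)) + (C a - X ^ 2) * derivative (C c * X ^ m)
        + C b * X * (C c * X ^ m)
      = C (c * (m * (m - 1 + a))) * X ^ (m - 1) + C (c * (b - m)) * X ^ (m + 1) := by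
  rcases m with _ | _ | m
  · simp; ring
  · simp; ring
  · simp
    ring

open Polynomial in
lemma genHermite_partial_ode (a : ℝ) (n K : ℕ) (hK : 2 * K ≤ n) :
    X * derivative (derivative (∑ k ∈ Finset.range (K + 1),
          C (genHermiteCoeff a n k) * X ^ (n - 2 * k)))
        + (C a - X ^ 2) * derivative (∑ k ∈ Finset.range (K + 1),
          C (genHermiteCoeff a n k) * X ^ (n - 2 * k))
        + C (n : ℝ) * X * (∑ k ∈ Finset.range (K + 1),
          C (genHermiteCoeff a n k) * X ^ (n - 2 * k))
      = C (genHermiteCoeff a n K * ((n - 2 * K) * (n - 2 * K - 1 + a)))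
          * X ^ (n - 2 * K - 1) := by
  induction K with
  | zero =>
    have := ode_monomial a (genHermiteCoeff a n 0) n n
    simp only [zero_add, Finset.sum_range_one, Nat.mul_zero, Nat.sub_zero]
    rw [this]
    simp
  | succ K ih =>
    have ih := ih (by omega)
    have h := ode_monomial a (genHermiteCoeff a n (K + 1)) n (n - 2 * (K + 1))
    have e1 : n - 2 * (K + 1) + 1 = n - 2 * K - 1 := by omega
    have e2 : ((n - 2 * (K + 1) : ℕ) : ℝ) = n - 2 * (K + 1) := by
      rw [Nat.cast_sub hK]; push_cast; ring
    rw [e1, e2] at h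
    have e3 : genHermiteCoeff a n (K + 1) * ((n : ℝ) - (n - 2 * (K + 1)))
        = - (genHermiteCoeff a n K * ((n - 2 * K) * (n - 2 * K - 1 + a))) := by
      rw [genHermiteCoeff]
      field_simp
      ring
    rw [e3] at h
    rw [Finset.sum_range_succ _ (K + 1), derivative_add, derivative_add]
    push_cast
    simp only [C_neg] at h
    linear_combination ih + h

open Polynomial in
/-- The eigenvalue equation of the generalized Hermite polynomials. -/
lemma genHermite_ode (a : ℝ) (n : ℕ) (h : a = 0 ∨ Even n) :
    X * derivative (derivative (genHermite a n)) + (C a - X ^ 2) * derivative (genHermite a n)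
      + C (n : ℝ) * X * genHermite a n = 0 := by
  rw [genHermite, genHermite_partial_ode a n (n / 2) (by omega)]
  rcases Nat.even_or_odd' n with ⟨k, hk | hk⟩
  · have : n / 2 = k := by omega
    rw [this, hk]; simp
  · have : n / 2 = k := by omega
    have ha : a = 0 := h.resolve_right (by rw [hk]; simp)
    rw [this, hk, ha]; simp

lemma genHermite_zero (a : ℝ) : genHermite a 0 = 1 := by
  simp [genHermite, genHermiteCoeff]

lemma genHermite_one (a : ℝ) : genHermite a 1 = Polynomial.X := by
  simp [genHermite, genHermiteCoeff]

/-- The admissible degrees: only even ones in the coordinates carrying a weight. -/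
def admDegree (a : ℝ) : Set ℕ := {n | 0 < a → Even n}

open Polynomial in
lemma X_pow_mem_span_genHermite (a : ℝ) (m : ℕ) (hm : m ∈ admDegree a) :
    (X ^ m : ℝ[X]) ∈ Submodule.span ℝ (genHermite a '' admDegree a) := by
  induction m using Nat.strong_induction_on with
  | _ m ih =>
    have h : (X ^ m : ℝ[X]) = genHermite a m - ∑ k ∈ Finset.range (m / 2),
        C (genHermiteCoeff a m (k + 1)) * X ^ (m - 2 * (k + 1)) := by
      rw [genHermite, Finset.sum_range_succ']
      simp [genHermiteCoeff]
    rw [h]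
    refine Submodule.sub_mem _ (Submodule.subset_span ⟨m, hm, rfl⟩)
      (Submodule.sum_mem _ fun k hk => ?_)
    have hk := Finset.mem_range.1 hk
    rw [← smul_eq_C_mul]
    refine Submodule.smul_mem _ _ (ih _ (by omega) fun ha => ?_)
    have := hm ha
    rw [Nat.even_sub (by omega)]
    simp [this]

/-- The exponent of the monomial generating the admissible polynomials. -/
noncomputable def genExp (a : ℝ) : ℕ := if 0 < a then 2 else 1

open Polynomial in
lemma X_pow_mul_genHermite_mem_span (a : ℝ) (n : ℕ) (hn : n ∈ admDegree a) :
    X ^ genExp a * genHermite a n ∈ Submodule.span ℝ (genHermite a '' admDegree a) := by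
  rw [genHermite, Finset.mul_sum]
  refine Submodule.sum_mem _ fun k hk => ?_
  have hk := Finset.mem_range.1 hk
  have : X ^ genExp a * (C (genHermiteCoeff a n k) * X ^ (n - 2 * k))
      = genHermiteCoeff a n k • (X ^ (genExp a + (n - 2 * k)) : ℝ[X]) := by
    rw [smul_eq_C_mul]; ring
  rw [this]
  refine Submodule.smul_mem _ _ (X_pow_mem_span_genHermite a _ fun ha => ?_)
  have := hn ha
  rw [genExp, if_pos ha, Nat.even_add, Nat.even_sub (by omega)]
  simp [this]

/-- One-dimensional density `t ^ a * exp (-t ^ 2 / 2)` on the half line (the line if `a = 0`). -/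
noncomputable def monDensity (a t : ℝ) : ℝ :=
  if 0 < a → 0 < t then t ^ a * Real.exp (-t ^ 2 / 2) else 0

lemma monDensity_zero_left (t : ℝ) : monDensity 0 t = Real.exp (-t ^ 2 / 2) := by
  simp [monDensity]

lemma monDensity_of_pos {a t : ℝ} (ht : 0 < t) :
    monDensity a t = t ^ a * Real.exp (-t ^ 2 / 2) := by
  simp [monDensity, ht]

lemma monDensity_of_nonpos {a t : ℝ} (ha : 0 < a) (ht : t ≤ 0) : monDensity a t = 0 := by
  simp [monDensity, ha, ht.not_gt]

lemma monDensity_nonneg {a : ℝ} (ha : 0 ≤ a) (t : ℝ) : 0 ≤ monDensity a t := by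
  rcases ha.eq_or_lt with rfl | ha
  · rw [monDensity_zero_left]; positivity
  · rcases le_or_gt t 0 with ht | ht
    · rw [monDensity_of_nonpos ha ht]
    · rw [monDensity_of_pos ht]; positivity

lemma continuousAt_monDensity_zero {a : ℝ} (ha : 0 < a) : ContinuousAt (monDensity a) 0 := by
  have h : ContinuousAt (fun t : ℝ => |t| ^ a) 0 :=
    (continuous_abs.continuousAt).rpow_const (Or.inr ha.le)
  rw [ContinuousAt, monDensity_of_nonpos ha le_rfl]
  rw [ContinuousAt, abs_zero, Real.zero_rpow ha.ne'] at h
  refine squeeze_zero (monDensity_nonneg ha.le) (fun t => ?_) h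
  rcases le_or_gt t 0 with ht | ht
  · rw [monDensity_of_nonpos ha ht]; positivity
  · rw [monDensity_of_pos ht, abs_of_pos ht]
    exact mul_le_of_le_one_right (by positivity)
      (Real.exp_le_one_iff.2 (by nlinarith [sq_nonneg t]))

open Polynomial in
lemma hasDerivAt_monDensity_mul (a : ℝ) (ha : 0 ≤ a) (n : ℕ) (hn : n ∈ admDegree a) (t : ℝ) :
    HasDerivAt (fun t => monDensity a t * (derivative (genHermite a n)).eval t)
      (-(n * (monDensity a t * (genHermite a n).eval t))) t := by
  have hode := genHermite_ode a n
    (ha.eq_or_lt.imp (fun h => h.symm) fun h => hn h)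
  have hq := (derivative (genHermite a n)).hasDerivAt t
  have hexp : HasDerivAt (fun t : ℝ => Real.exp (-t ^ 2 / 2)) (-t * Real.exp (-t ^ 2 / 2)) t := by
    have : HasDerivAt (fun t : ℝ => -t ^ 2 / 2) (-t) t := by
      have := ((hasDerivAt_pow 2 t).neg).div_const 2
      exact this.congr_deriv (by simp; ring)
    exact this.exp.congr_deriv (by ring)
  rcases ha.eq_or_lt with rfl | ha
  · simp only [monDensity_zero_left]
    have hode' : X * (derivative (derivative (genHermite 0 n)) - X * derivative (genHermite 0 n)
        + C (n : ℝ) * genHermite 0 n) = 0 := by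
      rw [← hode, C_0]; ring
    have h0 := congrArg (Polynomial.eval t)
      ((mul_eq_zero.1 hode').resolve_left Polynomial.X_ne_zero)
    simp only [eval_add, eval_sub, eval_mul, eval_X, eval_C, eval_zero] at h0
    refine (hexp.mul hq).congr_deriv ?_
    linear_combination Real.exp (-t ^ 2 / 2) * h0
  rcases lt_trichotomy t 0 with ht | rfl | ht
  · have : (fun t => monDensity a t * (derivative (genHermite a n)).eval t) =ᶠ[nhds t]
        fun _ => 0 := by
      filter_upwards [Iio_mem_nhds ht] with s hs
      rw [monDensity_of_nonpos ha (le_of_lt hs), zero_mul]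
    rw [monDensity_of_nonpos ha ht.le]
    simpa using (hasDerivAt_const t (0 : ℝ)).congr_of_eventuallyEq this
  · have h0 : (derivative (genHermite a n)).coeff 0 = 0 := by
      have := congrArg (Polynomial.eval 0) hode
      simpa [ha.ne', coeff_zero_eq_eval_zero] using this
    obtain ⟨g, hg⟩ := X_dvd_iff.2 h0
    rw [monDensity_of_nonpos ha le_rfl, hg]
    have hc : ContinuousAt (fun t => monDensity a t * g.eval t) 0 :=
      (continuousAt_monDensity_zero ha).mul g.continuous.continuousAt
    rw [hasDerivAt_iff_tendsto_slope]
    rw [ContinuousAt, monDensity_of_nonpos ha le_rfl] at hc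
    simp only [zero_mul, mul_zero, neg_zero] at hc ⊢
    refine (hc.mono_left nhdsWithin_le_nhds).congr' ?_
    filter_upwards [self_mem_nhdsWithin] with s hs
    have hs : s ≠ 0 := hs
    simp [slope_def_field, monDensity_of_nonpos ha le_rfl]
    field_simp
  · have hw : HasDerivAt (monDensity a)
        (a * t ^ (a - 1) * Real.exp (-t ^ 2 / 2) + t ^ a * (-t * Real.exp (-t ^ 2 / 2))) t := by
      refine (((hasDerivAt_id t).rpow_const (p := a) (Or.inl ht.ne')).mul
        hexp).congr_of_eventuallyEq ?_ |>.congr_deriv ?_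
      · filter_upwards [Ioi_mem_nhds ht] with s hs
        exact monDensity_of_pos hs
      · simp
    refine (hw.mul hq).congr_deriv ?_
    have h0 := congrArg (Polynomial.eval t) hode
    simp only [eval_add, eval_sub, eval_mul, eval_X, eval_C, eval_zero, eval_pow] at h0
    rw [monDensity_of_pos ht, Real.rpow_sub_one ht.ne']
    field_simp
    linear_combination h0

section MonGauss

variable {N : ℕ} {α : Fin N → ℝ}

/-- The unnormalized density of the monomial Gaussian measure on the whole space. -/
noncomputable def prodDensity (α : Fin N → ℝ) (x : EuclideanSpace ℝ (Fin N)) : ℝ :=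
  ∏ i, monDensity (α i) (x i)

lemma prodDensity_nonneg (hα : ∀ i, 0 ≤ α i) (x : EuclideanSpace ℝ (Fin N)) :
    0 ≤ prodDensity α x :=
  Finset.prod_nonneg fun i _ => monDensity_nonneg (hα i) _

lemma measurable_monDensity (a : ℝ) : Measurable (monDensity a) := by
  have hs : MeasurableSet {t : ℝ | 0 < a → 0 < t} := by
    by_cases ha : 0 < a
    · simp only [ha, true_imp_iff]
      exact measurableSet_Ioi
    · simp [ha]
  exact Measurable.ite hs (by fun_prop) measurable_const

@[fun_prop]
lemma measurable_prodDensity : Measurable (prodDensity α) :=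
  Finset.measurable_fun_prod _ fun i _ => (measurable_monDensity (α i)).comp (by fun_prop)

lemma measurableSet_chamber : MeasurableSet (chamber α) := by
  have : chamber α = ⋂ i, {x | 0 < α i → 0 < x i} := by
    ext x; simp [chamber]
  rw [this]
  refine MeasurableSet.iInter fun i => ?_
  by_cases ha : 0 < α i
  · simpa [ha] using measurableSet_lt measurable_const
      (by fun_prop : Measurable fun x : EuclideanSpace ℝ (Fin N) => x i)
  · simp [ha]

lemma indicator_chamber_eq_prodDensity (x : EuclideanSpace ℝ (Fin N)) :
    (chamber α).indicator (fun x => ENNReal.ofReal (monWeight α x * Real.exp (-‖x‖ ^ 2 / 2))) x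
      = ENNReal.ofReal (prodDensity α x) := by
  by_cases hx : x ∈ chamber α
  · rw [Set.indicator_of_mem hx]
    have hexp : Real.exp (-‖x‖ ^ 2 / 2) = ∏ i, Real.exp (-(x i) ^ 2 / 2) := by
      rw [← Real.exp_sum, EuclideanSpace.norm_sq_eq, ← Finset.sum_neg_distrib, Finset.sum_div]
      simp
    rw [hexp, monWeight, ← Finset.prod_mul_distrib, prodDensity]
    congr 1
    refine Finset.prod_congr rfl fun i _ => ?_
    rw [monDensity, if_pos (hx i)]
  · rw [Set.indicator_of_notMem hx]
    simp only [chamber, Set.mem_ofPred_eq, not_forall] at hx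
    obtain ⟨i, hi, hxi⟩ := hx
    rw [prodDensity, Finset.prod_eq_zero (Finset.mem_univ i), ENNReal.ofReal_zero]
    exact monDensity_of_nonpos hi (not_lt.1 hxi)

variable (α) in
/-- The unnormalized monomial Gaussian measure. -/
noncomputable def monMeasure : Measure (EuclideanSpace ℝ (Fin N)) :=
  volume.withDensity fun x => ENNReal.ofReal (prodDensity α x)

lemma monGauss_eq : monGauss α = (monMeasure α Set.univ)⁻¹ • monMeasure α := by
  have : (volume.restrict (chamber α)).withDensity
      (fun x => ENNReal.ofReal (monWeight α x * Real.exp (-‖x‖ ^ 2 / 2))) = monMeasure α := by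
    rw [← withDensity_indicator measurableSet_chamber, monMeasure]
    congr 1
    exact funext indicator_chamber_eq_prodDensity
  rw [monGauss, this]

lemma monDensity_le {a : ℝ} (ha : 0 ≤ a) (t : ℝ) :
    monDensity a t ≤ (1 + |t|) ^ ⌈a⌉₊ * Real.exp (-t ^ 2 / 2) := by
  rcases ha.eq_or_lt with rfl | ha
  · simp [monDensity_zero_left]
  rcases le_or_gt t 0 with ht | ht
  · rw [monDensity_of_nonpos ha ht]; positivity
  · rw [monDensity_of_pos ht, abs_of_pos ht]
    gcongr
    calc t ^ a ≤ (1 + t) ^ a := by gcongr; linarith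
      _ ≤ (1 + t) ^ (⌈a⌉₊ : ℝ) := by
        gcongr
        · linarith
        · exact Nat.le_ceil a
      _ = _ := Real.rpow_natCast _ _

lemma prodDensity_le (hα : ∀ i, 0 ≤ α i) (x : EuclideanSpace ℝ (Fin N)) :
    prodDensity α x ≤ (1 + ‖x‖) ^ (∑ i, ⌈α i⌉₊) * Real.exp (-‖x‖ ^ 2 / 2) := by
  have hexp : Real.exp (-‖x‖ ^ 2 / 2) = ∏ i, Real.exp (-(x i) ^ 2 / 2) := by
    rw [← Real.exp_sum, EuclideanSpace.norm_sq_eq, ← Finset.sum_neg_distrib, Finset.sum_div]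
    simp
  rw [hexp, ← Finset.prod_pow_eq_pow_sum, ← Finset.prod_mul_distrib]
  refine Finset.prod_le_prod (fun i _ => monDensity_nonneg (hα i) _) fun i _ => ?_
  refine (monDensity_le (hα i) _).trans ?_
  gcongr
  exact PiLp.norm_apply_le x i

lemma one_add_pow_mul_exp_le (p : ℕ) {r : ℝ} (hr : 0 ≤ r) :
    (1 + r) ^ p * Real.exp (-r ^ 2 / 4) ≤ p.factorial * Real.exp 2 := by
  have h := Real.pow_div_factorial_le_exp (1 + r) (by positivity) p
  rw [div_le_iff₀ (by positivity)] at h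
  calc (1 + r) ^ p * Real.exp (-r ^ 2 / 4)
      ≤ Real.exp (1 + r) * p.factorial * Real.exp (-r ^ 2 / 4) := by gcongr
    _ = p.factorial * Real.exp (1 + r + -r ^ 2 / 4) := by rw [Real.exp_add (1 + r)]; ring
    _ ≤ p.factorial * Real.exp 2 := by
      gcongr
      nlinarith [sq_nonneg (r - 2)]

lemma integrable_prodDensity_mul (hα : ∀ i, 0 ≤ α i) {g : EuclideanSpace ℝ (Fin N) → ℝ}
    (hg : AEStronglyMeasurable g) (C : ℝ) (k : ℕ)
    (hb : ∀ x, |g x| ≤ C * (1 + ‖x‖) ^ k * Real.exp (‖x‖ ^ 2 / 4)) :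
    Integrable (fun x => prodDensity α x * g x) := by
  have hC : 0 ≤ C := by
    have := (abs_nonneg _).trans (hb 0)
    simpa using this
  set M := ∑ i, ⌈α i⌉₊
  have hr : (Module.finrank ℝ (EuclideanSpace ℝ (Fin N)) : ℝ) < (N + 1 : ℕ) := by simp
  refine ((integrable_one_add_norm hr).const_mul
    (C * ((M + k + (N + 1)).factorial * Real.exp 2))).mono'
    (measurable_prodDensity.aestronglyMeasurable.mul hg) (Filter.Eventually.of_forall fun x => ?_)
  have h0 : (0 : ℝ) < 1 + ‖x‖ := by positivity
  rw [norm_mul, Real.norm_of_nonneg (prodDensity_nonneg hα x), Real.norm_eq_abs,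
    Real.rpow_neg h0.le, Real.rpow_natCast, ← div_eq_mul_inv, le_div_iff₀ (by positivity)]
  have he : Real.exp (-‖x‖ ^ 2 / 2) * Real.exp (‖x‖ ^ 2 / 4) = Real.exp (-‖x‖ ^ 2 / 4) := by
    rw [← Real.exp_add]; congr 1; ring
  calc prodDensity α x * |g x| * (1 + ‖x‖) ^ (N + 1)
      ≤ ((1 + ‖x‖) ^ M * Real.exp (-‖x‖ ^ 2 / 2))
          * (C * (1 + ‖x‖) ^ k * Real.exp (‖x‖ ^ 2 / 4)) * (1 + ‖x‖) ^ (N + 1) := by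
        gcongr
        · exact prodDensity_le hα x
        · exact hb x
    _ = C * ((1 + ‖x‖) ^ (M + k + (N + 1)) * Real.exp (-‖x‖ ^ 2 / 4)) := by
        rw [← he, pow_add, pow_add]; ring
    _ ≤ _ := by
        exact mul_le_mul_of_nonneg_left (one_add_pow_mul_exp_le _ (norm_nonneg x)) hC

lemma monMeasure_univ_ne_top (hα : ∀ i, 0 ≤ α i) : monMeasure α Set.univ ≠ ⊤ := by
  have h := integrable_prodDensity_mul hα (g := fun _ => 1) aestronglyMeasurable_const 1 0
    (fun x => by simpa using by positivity)
  simp only [mul_one] at h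
  rw [monMeasure, withDensity_apply _ MeasurableSet.univ, Measure.restrict_univ]
  exact h.lintegral_lt_top.ne

lemma monMeasure_univ_ne_zero : monMeasure α Set.univ ≠ 0 := by
  intro h
  rw [Measure.measure_univ_eq_zero, monMeasure, withDensity_eq_zero_iff (by fun_prop)] at h
  have ho : IsOpen {x : EuclideanSpace ℝ (Fin N) | ∀ i, 0 < x i} := by
    simp only [Set.ofPred_forall]
    exact isOpen_iInter_of_finite fun i => isOpen_lt continuous_const (by fun_prop)
  refine (ho.measure_pos volume ⟨WithLp.toLp 2 fun _ => 1, fun i => by simp⟩).ne' ?_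
  refine measure_mono_null (fun x hx => ?_) h
  have : 0 < prodDensity α x := Finset.prod_pos fun i _ => by
    rw [monDensity_of_pos (hx i)]
    have := hx i
    positivity
  simpa using this

lemma isProbabilityMeasure_monGauss (hα : ∀ i, 0 ≤ α i) : IsProbabilityMeasure (monGauss α) := by
  constructor
  rw [monGauss_eq, Measure.smul_apply, smul_eq_mul]
  exact ENNReal.inv_mul_cancel monMeasure_univ_ne_zero (monMeasure_univ_ne_top hα)

lemma integral_monGauss (hα : ∀ i, 0 ≤ α i) (g : EuclideanSpace ℝ (Fin N) → ℝ) :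
    ∫ x, g x ∂(monGauss α)
      = ((monMeasure α Set.univ)⁻¹).toReal * ∫ x, prodDensity α x * g x := by
  rw [monGauss_eq, integral_smul_measure, monMeasure,
    integral_withDensity_eq_integral_toReal_smul (by fun_prop) (by simp)]
  simp [ENNReal.toReal_ofReal (prodDensity_nonneg hα _)]

lemma integrable_monGauss (hα : ∀ i, 0 ≤ α i) {g : EuclideanSpace ℝ (Fin N) → ℝ}
    (hg : AEStronglyMeasurable g) (C : ℝ) (k : ℕ)
    (hb : ∀ x, |g x| ≤ C * (1 + ‖x‖) ^ k * Real.exp (‖x‖ ^ 2 / 4)) :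
    Integrable g (monGauss α) := by
  rw [monGauss_eq]
  refine Integrable.smul_measure ?_ (ENNReal.inv_ne_top.2 monMeasure_univ_ne_zero)
  rw [monMeasure, integrable_withDensity_iff_integrable_smul' (by fun_prop) (by simp)]
  simpa [ENNReal.toReal_ofReal (prodDensity_nonneg hα _)]
    using integrable_prodDensity_mul hα hg C k hb

lemma Function.HasTemperateGrowth.exists_abs_le {g : EuclideanSpace ℝ (Fin N) → ℝ}
    (hg : g.HasTemperateGrowth) :
    ∃ (C : ℝ) (k : ℕ), ∀ x, |g x| ≤ C * (1 + ‖x‖) ^ k * Real.exp (‖x‖ ^ 2 / 4) := by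
  obtain ⟨k, C, h⟩ := hg.2 0
  refine ⟨C, k, fun x => ?_⟩
  have hx := h x
  rw [norm_iteratedFDeriv_zero, Real.norm_eq_abs] at hx
  refine hx.trans (le_mul_of_one_le_right ((abs_nonneg _).trans hx) ?_)
  exact Real.one_le_exp (by positivity)

lemma Function.HasTemperateGrowth.integrable_monGauss (hα : ∀ i, 0 ≤ α i)
    {g : EuclideanSpace ℝ (Fin N) → ℝ} (hg : g.HasTemperateGrowth) :
    Integrable g (monGauss α) := by
  obtain ⟨C, k, h⟩ := hg.exists_abs_le
  exact _root_.integrable_monGauss hα hg.1.continuous.aestronglyMeasurable C k h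

lemma Function.HasTemperateGrowth.integrable_prodDensity_mul (hα : ∀ i, 0 ≤ α i)
    {g : EuclideanSpace ℝ (Fin N) → ℝ} (hg : g.HasTemperateGrowth) :
    Integrable (fun x => prodDensity α x * g x) := by
  obtain ⟨C, k, h⟩ := hg.exists_abs_le
  exact _root_.integrable_prodDensity_mul hα hg.1.continuous.aestronglyMeasurable C k h

lemma ae_mem_chamber : ∀ᵐ x ∂(monGauss α), x ∈ chamber α := by
  refine Measure.ae_smul_measure ?_ _
  exact (withDensity_absolutelyContinuous _ _).ae_le (ae_restrict_mem measurableSet_chamber)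

end MonGauss

section HermiteProd

variable {N : ℕ} {α : Fin N → ℝ}

/-- The product of generalized Hermite polynomials, an eigenfunction of eigenvalue `∑ i, n i`. -/
noncomputable def hermiteProd (α : Fin N → ℝ) (n : Fin N → ℕ) (x : EuclideanSpace ℝ (Fin N)) : ℝ :=
  ∏ i, (genHermite (α i) (n i)).eval (x i)

/-- The `i`-th partial derivative of `hermiteProd`. -/
noncomputable def hermiteProdDeriv (α : Fin N → ℝ) (n : Fin N → ℕ) (i : Fin N)
    (x : EuclideanSpace ℝ (Fin N)) : ℝ :=
  (Polynomial.derivative (genHermite (α i) (n i))).eval (x i)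
    * ∏ j ∈ Finset.univ.erase i, (genHermite (α j) (n j)).eval (x j)

lemma hasTemperateGrowth_coord (i : Fin N) :
    (fun x : EuclideanSpace ℝ (Fin N) => x i).HasTemperateGrowth :=
  (EuclideanSpace.proj i : EuclideanSpace ℝ (Fin N) →L[ℝ] ℝ).hasTemperateGrowth

lemma hasTemperateGrowth_eval_coord (p : Polynomial ℝ) (i : Fin N) :
    (fun x : EuclideanSpace ℝ (Fin N) => p.eval (x i)).HasTemperateGrowth := by
  induction p using Polynomial.induction_on' with
  | add p q hp hq =>
    simp only [Polynomial.eval_add]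
    exact hp.add hq
  | monomial n c =>
    simp only [Polynomial.eval_monomial]
    exact (Function.HasTemperateGrowth.const c).mul ((hasTemperateGrowth_coord i).pow n)

lemma hasTemperateGrowth_prod {ι : Type*} (s : Finset ι)
    {f : ι → EuclideanSpace ℝ (Fin N) → ℝ} (hf : ∀ i, (f i).HasTemperateGrowth) :
    (fun x => ∏ i ∈ s, f i x).HasTemperateGrowth := by
  classical
  induction s using Finset.induction_on with
  | empty => simp
  | insert a s ha ih =>
    simp only [Finset.prod_insert ha]
    exact (hf a).mul ih

lemma hasTemperateGrowth_hermiteProd (n : Fin N → ℕ) : (hermiteProd α n).HasTemperateGrowth :=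
  hasTemperateGrowth_prod _ fun i => hasTemperateGrowth_eval_coord _ i

lemma hasTemperateGrowth_hermiteProdDeriv (n : Fin N → ℕ) (i : Fin N) :
    (hermiteProdDeriv α n i).HasTemperateGrowth :=
  (hasTemperateGrowth_eval_coord _ i).mul
    (hasTemperateGrowth_prod _ fun i => hasTemperateGrowth_eval_coord _ i)

lemma hasLineDerivAt_prod_coord (f : Fin N → ℝ → ℝ) (i : Fin N) (x : EuclideanSpace ℝ (Fin N))
    {d : ℝ} (hf : HasDerivAt (f i) d (x i)) :
    HasLineDerivAt ℝ (fun x : EuclideanSpace ℝ (Fin N) => ∏ j, f j (x j))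
      (d * ∏ j ∈ Finset.univ.erase i, f j (x j)) x (EuclideanSpace.single i 1) := by
  have h : ∀ t : ℝ, ∏ j, f j ((x + t • EuclideanSpace.single i (1 : ℝ)) j)
      = f i (x i + t) * ∏ j ∈ Finset.univ.erase i, f j (x j) := by
    intro t
    rw [← Finset.mul_prod_erase _ _ (Finset.mem_univ i)]
    congr 1
    · simp
    · refine Finset.prod_congr rfl fun j hj => ?_
      simp [Finset.ne_of_mem_erase hj]
  rw [HasLineDerivAt]
  simp only [h]
  refine HasDerivAt.mul_const ?_ _
  have := HasDerivAt.comp_const_add (x i) 0 (f := f i) (f' := d) (by simpa using hf)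
  exact this

lemma hasLineDerivAt_hermiteProd (n : Fin N → ℕ) (i : Fin N) (x : EuclideanSpace ℝ (Fin N)) :
    HasLineDerivAt ℝ (hermiteProd α n) (hermiteProdDeriv α n i x) x
      (EuclideanSpace.single i 1) :=
  hasLineDerivAt_prod_coord (fun j t => (genHermite (α j) (n j)).eval t) i x
    (Polynomial.hasDerivAt _ _)

lemma hasLineDerivAt_prodDensity_mul (hα : ∀ i, 0 ≤ α i) (n : Fin N → ℕ)
    (hn : ∀ i, n i ∈ admDegree (α i)) (i : Fin N) (x : EuclideanSpace ℝ (Fin N)) :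
    HasLineDerivAt ℝ (fun x => prodDensity α x * hermiteProdDeriv α n i x)
      (-(n i * (prodDensity α x * hermiteProd α n x))) x (EuclideanSpace.single i 1) := by
  classical
  set f : Fin N → ℝ → ℝ := fun j t => monDensity (α j) t * (genHermite (α j) (n j)).eval t
  set F : Fin N → ℝ → ℝ := Function.update f i fun t =>
    monDensity (α i) t * (Polynomial.derivative (genHermite (α i) (n i))).eval t with hF
  have hd := hasDerivAt_monDensity_mul (α i) (hα i) (n i) (hn i) (x i)
  have hFi : F i = fun t =>
    monDensity (α i) t * (Polynomial.derivative (genHermite (α i) (n i))).eval t := by simp [hF]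
  have hFj : ∀ y : EuclideanSpace ℝ (Fin N), ∏ j ∈ Finset.univ.erase i, F j (y j)
      = ∏ j ∈ Finset.univ.erase i, f j (y j) := fun y =>
    Finset.prod_congr rfl fun j hj => by
      rw [hF, Function.update_of_ne (Finset.ne_of_mem_erase hj)]
  rw [← hFi] at hd
  have h := hasLineDerivAt_prod_coord F i x hd
  have e1 : (fun y : EuclideanSpace ℝ (Fin N) => ∏ j, F j (y j))
      = fun y => prodDensity α y * hermiteProdDeriv α n i y := by
    funext y
    rw [← Finset.mul_prod_erase _ _ (Finset.mem_univ i), hFj, hFi, prodDensity, hermiteProdDeriv,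
      ← Finset.mul_prod_erase _ (fun j => monDensity (α j) (y j)) (Finset.mem_univ i),
      Finset.prod_mul_distrib]
    ring
  have e2 : -(n i * (monDensity (α i) (x i) * (genHermite (α i) (n i)).eval (x i)))
        * ∏ j ∈ Finset.univ.erase i, F j (x j)
      = -(n i * (prodDensity α x * hermiteProd α n x)) := by
    rw [hFj, prodDensity, hermiteProd,
      ← Finset.mul_prod_erase _ (fun j => monDensity (α j) (x j)) (Finset.mem_univ i),
      ← Finset.mul_prod_erase _ (fun j => (genHermite (α j) (n j)).eval (x j))
        (Finset.mem_univ i), Finset.prod_mul_distrib]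
    ring
  rwa [e1, e2] at h

/-- Weak form of the eigenvalue equation of `hermiteProd` in the `i`-th coordinate. -/
lemma integral_mul_hermiteProdDeriv (hα : ∀ i, 0 ≤ α i) (n : Fin N → ℕ)
    (hn : ∀ i, n i ∈ admDegree (α i)) (i : Fin N) {f f' : EuclideanSpace ℝ (Fin N) → ℝ}
    (hf : f.HasTemperateGrowth) (hf' : f'.HasTemperateGrowth)
    (hd : ∀ x, HasLineDerivAt ℝ f (f' x) x (EuclideanSpace.single i 1)) :
    ∫ x, f' x * hermiteProdDeriv α n i x ∂(monGauss α)
      = n i * ∫ x, f x * hermiteProd α n x ∂(monGauss α) := by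
  have hH := hasTemperateGrowth_hermiteProd (α := α) n
  have hD := hasTemperateGrowth_hermiteProdDeriv (α := α) n i
  have h := integral_bilinear_hasLineDerivAt_right_eq_neg_left_of_integrable
    (μ := (volume : Measure (EuclideanSpace ℝ (Fin N)))) (f := f) (f' := f')
    (g := fun x => prodDensity α x * hermiteProdDeriv α n i x)
    (g' := fun x => -(n i * (prodDensity α x * hermiteProd α n x)))
    (v := EuclideanSpace.single i 1) (B := ContinuousLinearMap.mul ℝ ℝ)
    (((hf'.mul hD).integrable_prodDensity_mul hα).congr
      (Filter.Eventually.of_forall fun x => by simp; ring))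
    ((((hf.mul hH).integrable_prodDensity_mul hα).const_mul (-(n i : ℝ))).congr
      (Filter.Eventually.of_forall fun x => by simp; ring))
    (((hf.mul hD).integrable_prodDensity_mul hα).congr
      (Filter.Eventually.of_forall fun x => by simp; ring))
    (fun x _ => hd x) (fun x _ => hasLineDerivAt_prodDensity_mul hα n hn i x)
  simp only [ContinuousLinearMap.mul_apply'] at h
  have e1 : ∫ x, f x * -(n i * (prodDensity α x * hermiteProd α n x))
      = -(n i * ∫ x, prodDensity α x * (f x * hermiteProd α n x)) := by
    rw [← integral_const_mul, ← integral_neg]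
    congr 1; funext x; ring
  have e2 : ∫ x, f' x * (prodDensity α x * hermiteProdDeriv α n i x)
      = ∫ x, prodDensity α x * (f' x * hermiteProdDeriv α n i x) := by
    congr 1; funext x; ring
  rw [e1, e2, neg_inj] at h
  rw [integral_monGauss hα, integral_monGauss hα, ← h]
  ring

/-- `hermiteProd` is orthogonal for the monomial Gaussian measure. -/
lemma integral_hermiteProd_mul_of_ne (hα : ∀ i, 0 ≤ α i) {n m : Fin N → ℕ}
    (hn : ∀ i, n i ∈ admDegree (α i)) (hm : ∀ i, m i ∈ admDegree (α i)) (hne : n ≠ m) :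
    ∫ x, hermiteProd α n x * hermiteProd α m x ∂(monGauss α) = 0 := by
  obtain ⟨i, hi⟩ := Function.ne_iff.1 hne
  have h1 := integral_mul_hermiteProdDeriv hα n hn i (hasTemperateGrowth_hermiteProd (α := α) m)
    (hasTemperateGrowth_hermiteProdDeriv m i) (hasLineDerivAt_hermiteProd m i)
  have h2 := integral_mul_hermiteProdDeriv hα m hm i (hasTemperateGrowth_hermiteProd (α := α) n)
    (hasTemperateGrowth_hermiteProdDeriv n i) (hasLineDerivAt_hermiteProd n i)
  simp only [mul_comm (hermiteProdDeriv α m i _), mul_comm (hermiteProd α m _)] at h1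
  rw [h1] at h2
  have h3 : ((n i : ℝ) - m i) * ∫ x, hermiteProd α n x * hermiteProd α m x ∂(monGauss α) = 0 := by
    rw [sub_mul, h2, sub_self]
  refine (mul_eq_zero.1 h3).resolve_left (sub_ne_zero.2 ?_)
  exact_mod_cast hi

end HermiteProd

section Determinacy

open ProbabilityTheory

variable {Ω : Type*} {mΩ : MeasurableSpace Ω}

lemma map_eq_of_moments_eq {ρ₁ ρ₂ : Measure Ω} [IsFiniteMeasure ρ₁] [IsFiniteMeasure ρ₂]
    {s : Ω → ℝ} (hs : Measurable s) {δ : ℝ} (hδ : 0 < δ)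
    (h₁ : ∀ t ∈ Set.Ioo (-δ) δ, Integrable (fun x => Real.exp (t * s x)) ρ₁)
    (h₂ : ∀ t ∈ Set.Ioo (-δ) δ, Integrable (fun x => Real.exp (t * s x)) ρ₂)
    (hm : ∀ k : ℕ, ∫ x, s x ^ k ∂ρ₁ = ∫ x, s x ^ k ∂ρ₂) :
    ρ₁.map s = ρ₂.map s := by
  set U : Set ℂ := {z | z.re ∈ Set.Ioo (-δ) δ}
  have hU : IsPreconnected U :=
    ((convex_Ioo (-δ) δ).linear_preimage Complex.reLm).isPreconnected
  have hi₁ : Set.Ioo (-δ) δ ⊆ interior (integrableExpSet s ρ₁) := interior_maximal h₁ isOpen_Ioo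
  have hi₂ : Set.Ioo (-δ) δ ⊆ interior (integrableExpSet s ρ₂) := interior_maximal h₂ isOpen_Ioo
  have ha₁ : AnalyticOnNhd ℂ (complexMGF s ρ₁) U := fun z hz => analyticAt_complexMGF (hi₁ hz)
  have ha₂ : AnalyticOnNhd ℂ (complexMGF s ρ₂) U := fun z hz => analyticAt_complexMGF (hi₂ hz)
  have h0 : (0 : ℂ) ∈ U := by simp [U, hδ]
  have hev : complexMGF s ρ₁ =ᶠ[nhds 0] complexMGF s ρ₂ := by
    have han := (ha₁ 0 h0).sub (ha₂ 0 h0)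
    have : ∀ᶠ z in nhds 0, (complexMGF s ρ₁ - complexMGF s ρ₂) z = 0 := by
      rw [← analyticOrderAt_eq_top, ENat.eq_top_iff_forall_ge]
      intro n
      rw [natCast_le_analyticOrderAt_iff_iteratedDeriv_eq_zero han]
      intro i _
      rw [iteratedDeriv_sub (ha₁ 0 h0).contDiffAt (ha₂ 0 h0).contDiffAt,
        iteratedDeriv_complexMGF (hi₁ h0), iteratedDeriv_complexMGF (hi₂ h0), sub_eq_zero]
      simp only [zero_mul, Complex.exp_zero, mul_one]
      have := congrArg (fun r : ℝ => (r : ℂ)) (hm i)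
      simpa only [← integral_complex_ofReal, Complex.ofReal_pow] using this
    filter_upwards [this] with z hz
    simpa [sub_eq_zero] using hz
  refine Measure.ext_of_charFun (funext fun t => ?_)
  rw [← complexMGF_mul_I hs.aemeasurable, ← complexMGF_mul_I hs.aemeasurable]
  exact ha₁.eqOn_of_preconnected_of_eventuallyEq ha₂ hU h0 hev (by simp [U, hδ])

lemma map_eq_of_forall_map_inner_eq {E : Type*} [NormedAddCommGroup E] [InnerProductSpace ℝ E]
    [CompleteSpace E] [MeasurableSpace E] [BorelSpace E] [SecondCountableTopology E]
    {ρ₁ ρ₂ : Measure Ω} [IsFiniteMeasure ρ₁] [IsFiniteMeasure ρ₂] {T : Ω → E} (hT : Measurable T)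
    (h : ∀ ξ : E, ρ₁.map (fun x => inner ℝ (T x) ξ) = ρ₂.map (fun x => inner ℝ (T x) ξ)) :
    ρ₁.map T = ρ₂.map T := by
  refine Measure.ext_of_charFun (funext fun ξ => ?_)
  have key : ∀ ρ : Measure Ω, charFun (ρ.map T) ξ
      = ∫ y : ℝ, Complex.exp (y * Complex.I) ∂(ρ.map fun x => inner ℝ (T x) ξ) := by
    intro ρ
    rw [charFun_apply, integral_map hT.aemeasurable (by fun_prop),
      integral_map (by fun_prop) (by fun_prop)]
  rw [key, key, h]

lemma integrable_max_zero_mul {μ : Measure Ω} {f g : Ω → ℝ} (hf : Measurable f)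
    (hg : Measurable g) (hfg : Integrable (fun x => f x * g x) μ) :
    Integrable (fun x => max (f x) 0 * g x) μ := by
  refine hfg.mono (by fun_prop) (ae_of_all _ fun x => ?_)
  rw [norm_mul, norm_mul, Real.norm_of_nonneg (le_max_right _ _), Real.norm_eq_abs (f x)]
  gcongr ?_ * _
  exact max_le (le_abs_self _) (abs_nonneg _)

lemma integrable_withDensity_ofReal {μ : Measure Ω} {f g : Ω → ℝ} (hf : Measurable f)
    (hg : Measurable g) (hfg : Integrable (fun x => f x * g x) μ) :
    Integrable g (μ.withDensity fun x => ENNReal.ofReal (f x)) := by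
  rw [integrable_withDensity_iff_integrable_smul' (by fun_prop) (by simp)]
  simpa only [ENNReal.toReal_ofReal', smul_eq_mul] using integrable_max_zero_mul hf hg hfg

lemma integral_withDensity_sub {μ : Measure Ω} {f g : Ω → ℝ} (hf : Measurable f)
    (hg : Measurable g) (hfg : Integrable (fun x => f x * g x) μ) :
    ∫ x, g x ∂(μ.withDensity fun x => ENNReal.ofReal (f x))
      - ∫ x, g x ∂(μ.withDensity fun x => ENNReal.ofReal (-f x)) = ∫ x, f x * g x ∂μ := by
  rw [integral_withDensity_eq_integral_toReal_smul (by fun_prop) (by simp),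
    integral_withDensity_eq_integral_toReal_smul (by fun_prop) (by simp)]
  simp only [ENNReal.toReal_ofReal', smul_eq_mul]
  rw [← integral_sub (integrable_max_zero_mul hf hg hfg)
    (integrable_max_zero_mul (f := fun x => -f x) hf.neg hg (by simpa using hfg.neg))]
  refine integral_congr_ae (ae_of_all _ fun x => ?_)
  simp only [← sub_mul, max_zero_sub_max_neg_zero_eq_self]

lemma integral_mul_comp_eq_zero {E : Type*} [NormedAddCommGroup E] [InnerProductSpace ℝ E]
    [CompleteSpace E] [MeasurableSpace E] [BorelSpace E] [SecondCountableTopology E]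
    {μ : Measure Ω} {f : Ω → ℝ} (hf : Measurable f) (hfi : Integrable f μ)
    {T : Ω → E} (hT : Measurable T)
    (hexp : ∀ ξ : E, ∃ δ : ℝ, 0 < δ ∧ ∀ t ∈ Set.Ioo (-δ) δ,
      Integrable (fun x => f x * Real.exp (t * inner ℝ (T x) ξ)) μ)
    (hint : ∀ (ξ : E) (k : ℕ), Integrable (fun x => f x * inner ℝ (T x) ξ ^ k) μ)
    (hmom : ∀ (ξ : E) (k : ℕ), ∫ x, f x * inner ℝ (T x) ξ ^ k ∂μ = 0)
    {g : E → ℝ} (hg : Measurable g) (hfg : Integrable (fun x => f x * g (T x)) μ) :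
    ∫ x, f x * g (T x) ∂μ = 0 := by
  have := isFiniteMeasure_withDensity_ofReal hfi.2
  have := isFiniteMeasure_withDensity_ofReal hfi.neg.2
  have hmap : (μ.withDensity fun x => ENNReal.ofReal (f x)).map T
      = (μ.withDensity fun x => ENNReal.ofReal (-f x)).map T := by
    refine map_eq_of_forall_map_inner_eq hT fun ξ => ?_
    obtain ⟨δ, hδ, h⟩ := hexp ξ
    refine map_eq_of_moments_eq (by fun_prop) hδ (fun t ht => ?_) (fun t ht => ?_) fun k => ?_
    · exact integrable_withDensity_ofReal hf (by fun_prop) (h t ht)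
    · exact integrable_withDensity_ofReal hf.neg (by fun_prop) (by simpa using (h t ht).neg)
    · rw [← sub_eq_zero, integral_withDensity_sub hf (by fun_prop) (hint ξ k), hmom]
  rw [← integral_withDensity_sub hf (g := fun x => g (T x)) (by fun_prop) hfg, sub_eq_zero,
    ← integral_map hT.aemeasurable hg.aestronglyMeasurable, hmap,
    integral_map hT.aemeasurable hg.aestronglyMeasurable]

end Determinacy

section Density

variable {N : ℕ} {α : Fin N → ℝ}

variable (α) in
/-- The span of the products of generalized Hermite polynomials of admissible degrees. -/
noncomputable def hermiteSpan : Submodule ℝ (EuclideanSpace ℝ (Fin N) → ℝ) :=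
  Submodule.span ℝ (hermiteProd α '' {n | ∀ i, n i ∈ admDegree (α i)})

lemma hermiteSpan_hasTemperateGrowth {w : EuclideanSpace ℝ (Fin N) → ℝ} (hw : w ∈ hermiteSpan α) :
    w.HasTemperateGrowth := by
  induction hw using Submodule.span_induction with
  | mem w hw =>
    obtain ⟨n, -, rfl⟩ := hw
    exact hasTemperateGrowth_hermiteProd n
  | zero => exact Function.HasTemperateGrowth.const 0
  | add v w _ _ hv hw => exact hv.add hw
  | smul c w _ hw => exact (Function.HasTemperateGrowth.const c).mul hw

lemma coord_pow_mul_mem_hermiteSpan (i : Fin N) {w : EuclideanSpace ℝ (Fin N) → ℝ}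
    (hw : w ∈ hermiteSpan α) : (fun x => x i ^ genExp (α i) * w x) ∈ hermiteSpan α := by
  classical
  induction hw using Submodule.span_induction with
  | mem w hw =>
    obtain ⟨n, hn, rfl⟩ := hw
    let Φ : Polynomial ℝ →ₗ[ℝ] EuclideanSpace ℝ (Fin N) → ℝ :=
      { toFun p x := p.eval (x i) * ∏ j ∈ Finset.univ.erase i, (genHermite (α j) (n j)).eval (x j)
        map_add' p q := by ext x; simp [add_mul]
        map_smul' c p := by ext x; simp [mul_assoc] }
    have hΦ : Submodule.span ℝ (genHermite (α i) '' admDegree (α i))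
        ≤ (hermiteSpan α).comap Φ := by
      rw [Submodule.span_le]
      rintro _ ⟨k, hk, rfl⟩
      refine Submodule.subset_span ⟨Function.update n i k, fun j => ?_, ?_⟩
      · rcases eq_or_ne j i with rfl | hj
        · simpa using hk
        · simpa [hj] using hn j
      · ext x
        simp only [hermiteProd, ← Finset.mul_prod_erase _ _ (Finset.mem_univ i), Φ,
          LinearMap.coe_mk, AddHom.coe_mk, Function.update_self]
        congr 1
        refine Finset.prod_congr rfl fun j hj => ?_
        simp [Finset.ne_of_mem_erase hj]
    have h := hΦ (X_pow_mul_genHermite_mem_span (α i) (n i) (hn i))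
    rw [Submodule.mem_comap] at h
    convert h using 1
    ext x
    simp [Φ, hermiteProd, ← Finset.mul_prod_erase _ _ (Finset.mem_univ i), mul_assoc]
  | zero =>
    simp only [Pi.zero_apply, mul_zero]
    exact Submodule.zero_mem _
  | add v w _ _ hv hw =>
    simp only [Pi.add_apply, mul_add]
    exact Submodule.add_mem _ hv hw
  | smul c w _ hw =>
    simp only [Pi.smul_apply, mul_smul_comm]
    exact Submodule.smul_mem _ c hw

/-- The map `x ↦ (x i ^ genExp (α i))ᵢ`, injective on the chamber. -/
noncomputable def powMap (α : Fin N → ℝ) (x : EuclideanSpace ℝ (Fin N)) :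
    EuclideanSpace ℝ (Fin N) :=
  WithLp.toLp 2 fun i => x i ^ genExp (α i)

lemma measurable_powMap : Measurable (powMap α) := by
  unfold powMap
  fun_prop

lemma inner_powMap (x ξ : EuclideanSpace ℝ (Fin N)) :
    inner ℝ (powMap α x) ξ = ∑ i, ξ i * x i ^ genExp (α i) := by
  simp [powMap, PiLp.inner_apply]

lemma inner_powMap_pow_mem_hermiteSpan (ξ : EuclideanSpace ℝ (Fin N)) (k : ℕ) :
    (fun x => inner ℝ (powMap α x) ξ ^ k) ∈ hermiteSpan α := by
  induction k with
  | zero =>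
    refine Submodule.subset_span ⟨0, fun i _ => by simp, ?_⟩
    ext x
    simp [hermiteProd, genHermite_zero]
  | succ k ih =>
    have : (fun x => inner ℝ (powMap α x) ξ ^ (k + 1))
        = ∑ i, ξ i • fun x => x i ^ genExp (α i) * inner ℝ (powMap α x) ξ ^ k := by
      ext x
      rw [pow_succ']
      nth_rw 1 [inner_powMap]
      simp [Finset.sum_mul, mul_assoc]
    rw [this]
    exact Submodule.sum_mem _ fun i _ =>
      Submodule.smul_mem _ _ (coord_pow_mul_mem_hermiteSpan i ih)

lemma abs_inner_powMap_le (x ξ : EuclideanSpace ℝ (Fin N)) :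
    |inner ℝ (powMap α x) ξ| ≤ (∑ i, |ξ i|) * (1 + ‖x‖ ^ 2) := by
  rw [inner_powMap, Finset.sum_mul]
  refine (Finset.abs_sum_le_sum_abs _ _).trans (Finset.sum_le_sum fun i _ => ?_)
  rw [abs_mul, abs_pow]
  have hx : |x i| ≤ ‖x‖ := PiLp.norm_apply_le x i
  gcongr
  unfold genExp
  split_ifs
  · nlinarith [abs_nonneg (x i)]
  · nlinarith [abs_nonneg (x i), sq_nonneg (‖x‖ - 1)]

lemma Function.HasTemperateGrowth.memLp_monGauss (hα : ∀ i, 0 ≤ α i)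
    {g : EuclideanSpace ℝ (Fin N) → ℝ} (hg : g.HasTemperateGrowth) :
    MemLp g 2 (monGauss α) := by
  rw [memLp_two_iff_integrable_sq hg.1.continuous.aestronglyMeasurable]
  exact (hg.pow 2).integrable_monGauss hα

lemma exists_memLp_exp_inner_powMap (hα : ∀ i, 0 ≤ α i) (ξ : EuclideanSpace ℝ (Fin N)) :
    ∃ δ : ℝ, 0 < δ ∧ ∀ t ∈ Set.Ioo (-δ) δ,
      MemLp (fun x => Real.exp (t * inner ℝ (powMap α x) ξ)) 2 (monGauss α) := by
  have hm := measurable_powMap (α := α)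
  set B := ∑ i, |ξ i|
  have hB : 0 ≤ B := Finset.sum_nonneg fun i _ => abs_nonneg _
  refine ⟨1 / (8 * (B + 1)), by positivity, fun t ht => ?_⟩
  rw [memLp_two_iff_integrable_sq (Measurable.aestronglyMeasurable (by fun_prop))]
  refine integrable_monGauss hα (Measurable.aestronglyMeasurable (by fun_prop))
    (Real.exp (1 / 4)) 0 fun x => ?_
  rw [abs_of_nonneg (by positivity), ← Real.exp_nat_mul, pow_zero, mul_one, ← Real.exp_add]
  gcongr
  have h1 : |t| * B ≤ 1 / 8 := by
    have : |t| ≤ 1 / (8 * (B + 1)) := (abs_lt.2 ht).le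
    calc |t| * B ≤ 1 / (8 * (B + 1)) * (B + 1) := by gcongr; linarith
      _ = 1 / 8 := by field_simp
  have h2 : t * inner ℝ (powMap α x) ξ ≤ 1 / 8 * (1 + ‖x‖ ^ 2) :=
    calc t * inner ℝ (powMap α x) ξ ≤ |t| * |inner ℝ (powMap α x) ξ| := by
          rw [← abs_mul]; exact le_abs_self _
      _ ≤ |t| * (B * (1 + ‖x‖ ^ 2)) := by gcongr; exact abs_inner_powMap_le x ξ
      _ = |t| * B * (1 + ‖x‖ ^ 2) := by ring
      _ ≤ 1 / 8 * (1 + ‖x‖ ^ 2) := by gcongr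
  push_cast
  linarith

lemma integral_mul_eq_zero_of_mem_hermiteSpan (hα : ∀ i, 0 ≤ α i)
    {f w : EuclideanSpace ℝ (Fin N) → ℝ} (hf : MemLp f 2 (monGauss α))
    (h : ∀ n, (∀ i, n i ∈ admDegree (α i)) → ∫ x, f x * hermiteProd α n x ∂(monGauss α) = 0)
    (hw : w ∈ hermiteSpan α) : ∫ x, f x * w x ∂(monGauss α) = 0 := by
  induction hw using Submodule.span_induction with
  | mem w hw =>
    obtain ⟨n, hn, rfl⟩ := hw
    exact h n hn
  | zero => simp
  | add v w hv' hw' hv hw =>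
    simp only [Pi.add_apply, mul_add]
    rw [integral_add, hv, hw, add_zero]
    · exact hf.integrable_mul ((hermiteSpan_hasTemperateGrowth hv').memLp_monGauss hα)
    · exact hf.integrable_mul ((hermiteSpan_hasTemperateGrowth hw').memLp_monGauss hα)
  | smul c w _ hw =>
    simp only [Pi.smul_apply, mul_smul_comm]
    rw [integral_smul, hw, smul_zero]

lemma integral_mul_eq_zero_of_orthogonal (hα : ∀ i, 0 ≤ α i)
    {f U : EuclideanSpace ℝ (Fin N) → ℝ} (hfm : Measurable f) (hf : MemLp f 2 (monGauss α))
    (h : ∀ n, (∀ i, n i ∈ admDegree (α i)) → ∫ x, f x * hermiteProd α n x ∂(monGauss α) = 0)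
    (hUm : Measurable U) (hU : MemLp U 2 (monGauss α)) :
    ∫ x, f x * U x ∂(monGauss α) = 0 := by
  have := isProbabilityMeasure_monGauss hα
  set r : EuclideanSpace ℝ (Fin N) → EuclideanSpace ℝ (Fin N) :=
    fun y => WithLp.toLp 2 fun i => if 0 < α i then √(y i) else y i with hr
  have hrm : Measurable r := by
    refine (WithLp.measurable_toLp 2 _).comp (measurable_pi_lambda _ fun i => ?_)
    split_ifs <;> fun_prop
  have hae : (fun x => f x * U x) =ᵐ[monGauss α] fun x => f x * (U ∘ r) (powMap α x) := by
    filter_upwards [ae_mem_chamber] with x hx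
    have : r (powMap α x) = x := by
      ext i
      by_cases hi : 0 < α i
      · simp [hr, powMap, genExp, hi, Real.sqrt_sq (hx i hi).le]
      · simp [hr, powMap, genExp, hi]
    rw [Function.comp_apply, this]
  rw [integral_congr_ae hae]
  refine integral_mul_comp_eq_zero hfm (hf.integrable (by norm_num)) measurable_powMap
    (fun ξ => ?_) (fun ξ k => ?_) (fun ξ k => ?_) (hUm.comp hrm) ?_
  · obtain ⟨δ, hδ, hexp⟩ := exists_memLp_exp_inner_powMap hα ξ
    exact ⟨δ, hδ, fun t ht => hf.integrable_mul (hexp t ht)⟩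
  · exact hf.integrable_mul ((hermiteSpan_hasTemperateGrowth
      (inner_powMap_pow_mem_hermiteSpan ξ k)).memLp_monGauss hα)
  · exact integral_mul_eq_zero_of_mem_hermiteSpan hα hf h (inner_powMap_pow_mem_hermiteSpan ξ k)
  · exact (hf.integrable_mul hU).congr hae

lemma exists_hermiteProd_approx (hα : ∀ i, 0 ≤ α i) {U : EuclideanSpace ℝ (Fin N) → ℝ}
    (hU : MemLp U 2 (monGauss α)) {ε : ℝ} (hε : 0 < ε) :
    ∃ (S : Finset (Fin N → ℕ)) (b : (Fin N → ℕ) → ℝ), (∀ n ∈ S, ∀ i, n i ∈ admDegree (α i)) ∧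
      ∫ x, (U x - ∑ n ∈ S, b n * hermiteProd α n x) ^ 2 ∂(monGauss α) < ε := by
  have hH : ∀ n, MemLp (hermiteProd α n) 2 (monGauss α) := fun n =>
    (hasTemperateGrowth_hermiteProd n).memLp_monGauss hα
  set e : (Fin N → ℕ) → Lp ℝ 2 (monGauss α) := fun n => (hH n).toLp with he
  set A : Set (Fin N → ℕ) := {n | ∀ i, n i ∈ admDegree (α i)}
  have hdense : (Submodule.span ℝ (e '' A)).topologicalClosure = ⊤ := by
    rw [Submodule.topologicalClosure_eq_top_iff, Submodule.eq_bot_iff]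
    intro f hf
    have hfm : Measurable f := (Lp.stronglyMeasurable f).measurable
    have h0 : ∫ x, f x * f x ∂(monGauss α) = 0 := by
      refine integral_mul_eq_zero_of_orthogonal hα hfm (Lp.memLp f) (fun n hn => ?_) hfm
        (Lp.memLp f)
      have := hf (e n) (Submodule.subset_span ⟨n, hn, rfl⟩)
      rw [L2.inner_def] at this
      rw [← this]
      refine integral_congr_ae ?_
      filter_upwards [(hH n).coeFn_toLp] with x hx
      simp [he, hx]
    rw [← inner_self_eq_zero (𝕜 := ℝ), L2.inner_def]
    exact h0
  have hmem : hU.toLp ∈ closure (Submodule.span ℝ (e '' A) : Set (Lp ℝ 2 (monGauss α))) := by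
    rw [← Submodule.topologicalClosure_coe, hdense]
    trivial
  obtain ⟨k, hk, hdist⟩ := Metric.mem_closure_iff.1 hmem (√ε) (by positivity)
  obtain ⟨b, hb, rfl⟩ := (Finsupp.mem_span_image_iff_linearCombination ℝ).1 hk
  refine ⟨b.support, b, fun n hn => hb hn, ?_⟩
  have hsum : (Finsupp.linearCombination ℝ e b : Lp ℝ 2 (monGauss α)) =ᵐ[monGauss α]
      fun x => ∑ n ∈ b.support, b n * hermiteProd α n x := by
    rw [Finsupp.linearCombination_apply, Finsupp.sum]
    have h2 : ∀ᵐ x ∂(monGauss α), ∀ n ∈ b.support,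
        (b n • e n : Lp ℝ 2 (monGauss α)) x = b n * hermiteProd α n x := by
      rw [Finset.eventually_all]
      intro n _
      filter_upwards [Lp.coeFn_smul (b n) (e n), (hH n).coeFn_toLp] with x hx hx'
      rw [hx, Pi.smul_apply, hx', smul_eq_mul]
    filter_upwards [Lp.coeFn_finsetSum b.support fun n => b n • e n, h2] with x hx hx'
    rw [hx, Finset.sum_apply]
    exact Finset.sum_congr rfl hx'
  rw [dist_eq_norm, Real.lt_sqrt (norm_nonneg _), ← real_inner_self_eq_norm_sq, L2.inner_def]
    at hdist
  convert hdist using 1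
  refine integral_congr_ae ?_
  filter_upwards [Lp.coeFn_sub hU.toLp (Finsupp.linearCombination ℝ e b), hsum, hU.coeFn_toLp]
    with x h1 h2 h3
  rw [h1, Pi.sub_apply, h2, h3]
  simp [sq]

end Density

section HermiteSum

variable {N : ℕ} {α : Fin N → ℝ} {S : Finset (Fin N → ℕ)} {b c : (Fin N → ℕ) → ℝ}

/-- A finite linear combination of products of generalized Hermite polynomials. -/
noncomputable def hermiteSum (α : Fin N → ℝ) (S : Finset (Fin N → ℕ)) (c : (Fin N → ℕ) → ℝ)
    (x : EuclideanSpace ℝ (Fin N)) : ℝ :=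
  ∑ n ∈ S, c n * hermiteProd α n x

/-- The `i`-th partial derivative of `hermiteSum`. -/
noncomputable def hermiteSumDeriv (α : Fin N → ℝ) (S : Finset (Fin N → ℕ))
    (c : (Fin N → ℕ) → ℝ) (i : Fin N) (x : EuclideanSpace ℝ (Fin N)) : ℝ :=
  ∑ n ∈ S, c n * hermiteProdDeriv α n i x

lemma hasTemperateGrowth_hermiteSum : (hermiteSum α S c).HasTemperateGrowth :=
  Function.HasTemperateGrowth.sum fun n _ =>
    (Function.HasTemperateGrowth.const (c n)).mul (hasTemperateGrowth_hermiteProd n)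

lemma hasTemperateGrowth_hermiteSumDeriv (i : Fin N) :
    (hermiteSumDeriv α S c i).HasTemperateGrowth :=
  Function.HasTemperateGrowth.sum fun n _ =>
    (Function.HasTemperateGrowth.const (c n)).mul (hasTemperateGrowth_hermiteProdDeriv n i)

lemma hasLineDerivAt_hermiteSum (i : Fin N) (x : EuclideanSpace ℝ (Fin N)) :
    HasLineDerivAt ℝ (hermiteSum α S c) (hermiteSumDeriv α S c i x) x
      (EuclideanSpace.single i 1) :=
  HasDerivAt.fun_sum fun n _ => HasDerivAt.const_mul (c n) (hasLineDerivAt_hermiteProd n i x)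

lemma integral_mul_hermiteSum (hα : ∀ i, 0 ≤ α i) {f : EuclideanSpace ℝ (Fin N) → ℝ}
    (hf : f.HasTemperateGrowth) :
    ∫ x, f x * hermiteSum α S c x ∂(monGauss α)
      = ∑ n ∈ S, c n * ∫ x, f x * hermiteProd α n x ∂(monGauss α) := by
  simp only [hermiteSum, Finset.mul_sum, mul_left_comm _ (c _)]
  rw [integral_finsetSum]
  · simp only [integral_const_mul]
  · exact fun n _ =>
      ((hf.mul (hasTemperateGrowth_hermiteProd n)).integrable_monGauss hα).const_mul (c n)

lemma integral_mul_hermiteSumDeriv (hα : ∀ i, 0 ≤ α i)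
    (hS : ∀ n ∈ S, ∀ i, n i ∈ admDegree (α i)) {f f' : EuclideanSpace ℝ (Fin N) → ℝ} {i : Fin N}
    (hf : f.HasTemperateGrowth) (hf' : f'.HasTemperateGrowth)
    (hd : ∀ x, HasLineDerivAt ℝ f (f' x) x (EuclideanSpace.single i 1)) :
    ∫ x, f' x * hermiteSumDeriv α S c i x ∂(monGauss α)
      = ∑ n ∈ S, c n * (n i * ∫ x, f x * hermiteProd α n x ∂(monGauss α)) := by
  simp only [hermiteSumDeriv, Finset.mul_sum, mul_left_comm _ (c _)]
  rw [integral_finsetSum]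
  · refine Finset.sum_congr rfl fun n hn => ?_
    rw [integral_const_mul, integral_mul_hermiteProdDeriv hα n (hS n hn) i hf hf' hd]
  · exact fun n _ =>
      ((hf'.mul (hasTemperateGrowth_hermiteProdDeriv n i)).integrable_monGauss hα).const_mul (c n)

lemma sum_integral_mul_hermiteSumDeriv (hα : ∀ i, 0 ≤ α i)
    (hS : ∀ n ∈ S, ∀ i, n i ∈ admDegree (α i)) {f : EuclideanSpace ℝ (Fin N) → ℝ}
    {f' : Fin N → EuclideanSpace ℝ (Fin N) → ℝ}
    (hf : f.HasTemperateGrowth) (hf' : ∀ i, (f' i).HasTemperateGrowth)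
    (hd : ∀ i x, HasLineDerivAt ℝ f (f' i x) x (EuclideanSpace.single i 1)) :
    ∑ i, ∫ x, f' i x * hermiteSumDeriv α S c i x ∂(monGauss α)
      = ∑ n ∈ S, c n * (∑ i, (n i : ℝ)) * ∫ x, f x * hermiteProd α n x ∂(monGauss α) := by
  simp only [integral_mul_hermiteSumDeriv hα hS hf (hf' _) (hd _)]
  rw [Finset.sum_comm]
  simp only [← Finset.mul_sum, ← Finset.sum_mul, mul_assoc]

lemma hermiteProd_zero : hermiteProd α 0 = fun _ => 1 := by
  ext x
  simp [hermiteProd, genHermite_zero]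

lemma hermiteProd_single (j : Fin N) : hermiteProd α (Pi.single j 1) = fun x => x j := by
  classical
  ext x
  rw [hermiteProd, Finset.prod_eq_single j]
  · simp [genHermite_one]
  · intro i _ hij
    simp [hij, genHermite_zero]
  · simp

lemma hermiteProdDeriv_single (j : Fin N) :
    hermiteProdDeriv α (Pi.single j 1) j = fun _ => 1 := by
  classical
  ext x
  rw [hermiteProdDeriv, Finset.prod_eq_one]
  · simp [genHermite_one]
  · intro i hi
    simp [Finset.ne_of_mem_erase hi, genHermite_zero]

lemma single_admissible {j : Fin N} (hj : α j = 0) (i : Fin N) :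
    (Pi.single j 1 : Fin N → ℕ) i ∈ admDegree (α i) := by
  intro hi
  have : i ≠ j := by rintro rfl; exact hi.ne' hj
  simp [this]

/-- Integration by parts against a coordinate carrying no weight. -/
lemma integral_mul_coord (hα : ∀ i, 0 ≤ α i) {j : Fin N} (hj : α j = 0)
    {f f' : EuclideanSpace ℝ (Fin N) → ℝ}
    (hf : f.HasTemperateGrowth) (hf' : f'.HasTemperateGrowth)
    (hd : ∀ x, HasLineDerivAt ℝ f (f' x) x (EuclideanSpace.single j 1)) :
    ∫ x, f x * x j ∂(monGauss α) = ∫ x, f' x ∂(monGauss α) := by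
  have := integral_mul_hermiteProdDeriv hα _ (single_admissible hj) j hf hf' hd
  simpa [hermiteProd_single, hermiteProdDeriv_single] using this.symm

lemma hasLineDerivAt_coord (j i : Fin N) (r : ℝ) (x : EuclideanSpace ℝ (Fin N)) :
    HasLineDerivAt ℝ (fun x : EuclideanSpace ℝ (Fin N) => x j - r) (if j = i then 1 else 0) x
      (EuclideanSpace.single i 1) := by
  have h := ((EuclideanSpace.proj j : EuclideanSpace ℝ (Fin N) →L[ℝ] ℝ).hasFDerivAt
    (x := x)).sub_const r |>.hasLineDerivAt (EuclideanSpace.single i 1)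
  simpa [Pi.single_apply] using h

lemma integral_coord_eq_zero (hα : ∀ i, 0 ≤ α i) {j : Fin N} (hj : α j = 0) :
    ∫ x, x j ∂(monGauss α) = 0 := by
  simpa using integral_mul_coord hα hj (Function.HasTemperateGrowth.const 1)
    (Function.HasTemperateGrowth.const 0)
    fun x => (hasFDerivAt_const (1 : ℝ) x).hasLineDerivAt _

lemma integral_coord_mul_self (hα : ∀ i, 0 ≤ α i) {j : Fin N} (hj : α j = 0) :
    ∫ x, x j * x j ∂(monGauss α) = 1 := by
  have := isProbabilityMeasure_monGauss hα
  have h := integral_mul_coord hα hj (f' := fun _ => 1) (hasTemperateGrowth_coord j)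
    (Function.HasTemperateGrowth.const 1)
    fun x => by simpa using hasLineDerivAt_coord j j 0 x
  simpa using h

/-- The coefficients of the solution of `L φ = w` for the generator `L`. -/
noncomputable def solCoeff (b : (Fin N → ℕ) → ℝ) (n : Fin N → ℕ) : ℝ := b n / ∑ i, (n i : ℝ)

lemma sum_eq_zero_iff_eq_zero (n : Fin N → ℕ) : ∑ i, (n i : ℝ) = 0 ↔ n = 0 := by
  rw [← Nat.cast_sum, Nat.cast_eq_zero, Finset.sum_eq_zero_iff]
  simp [funext_iff]

lemma solCoeff_mul {n : Fin N → ℕ} (hn : n ≠ 0) : solCoeff b n * ∑ i, (n i : ℝ) = b n :=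
  div_mul_cancel₀ _ (by simpa [sum_eq_zero_iff_eq_zero] using hn)

lemma sum_integral_mul_solDeriv (hα : ∀ i, 0 ≤ α i)
    (hS : ∀ n ∈ S, ∀ i, n i ∈ admDegree (α i)) {f : EuclideanSpace ℝ (Fin N) → ℝ}
    {f' : Fin N → EuclideanSpace ℝ (Fin N) → ℝ}
    (hf : f.HasTemperateGrowth) (hf' : ∀ i, (f' i).HasTemperateGrowth)
    (hd : ∀ i x, HasLineDerivAt ℝ f (f' i x) x (EuclideanSpace.single i 1))
    (hm : ∫ x, f x ∂(monGauss α) = 0) :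
    ∑ i, ∫ x, f' i x * hermiteSumDeriv α S (solCoeff b) i x ∂(monGauss α)
      = ∫ x, f x * hermiteSum α S b x ∂(monGauss α) := by
  rw [sum_integral_mul_hermiteSumDeriv hα hS hf hf' hd, integral_mul_hermiteSum hα hf]
  refine Finset.sum_congr rfl fun n _ => ?_
  rcases eq_or_ne n 0 with rfl | hn
  · simp [hermiteProd_zero, hm]
  · rw [solCoeff_mul hn]

lemma integral_hermiteSum_mul_hermiteProd (hα : ∀ i, 0 ≤ α i)
    (hS : ∀ n ∈ S, ∀ i, n i ∈ admDegree (α i)) {n : Fin N → ℕ} (hn : ∀ i, n i ∈ admDegree (α i)) :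
    ∫ x, hermiteSum α S c x * hermiteProd α n x ∂(monGauss α)
      = if n ∈ S then c n * ∫ x, hermiteProd α n x * hermiteProd α n x ∂(monGauss α) else 0 := by
  simp only [mul_comm (hermiteSum α S c _)]
  rw [integral_mul_hermiteSum hα (hasTemperateGrowth_hermiteProd n)]
  refine (Finset.sum_congr rfl fun m hm => ?_).trans (Finset.sum_ite_eq S n fun m =>
    c m * ∫ x, hermiteProd α m x * hermiteProd α m x ∂(monGauss α))
  split_ifs with h
  · rw [h]
  · rw [integral_hermiteProd_mul_of_ne hα hn (hS m hm) h, mul_zero]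

lemma integral_hermiteSum_sq (hα : ∀ i, 0 ≤ α i) (hS : ∀ n ∈ S, ∀ i, n i ∈ admDegree (α i)) :
    ∫ x, hermiteSum α S b x * hermiteSum α S b x ∂(monGauss α)
      = ∑ n ∈ S, b n ^ 2 * ∫ x, hermiteProd α n x * hermiteProd α n x ∂(monGauss α) := by
  rw [integral_mul_hermiteSum hα hasTemperateGrowth_hermiteSum]
  refine Finset.sum_congr rfl fun n hn => ?_
  rw [integral_hermiteSum_mul_hermiteProd hα hS (hS n hn), if_pos hn]
  ring

lemma sum_integral_hermiteSumDeriv_sq (hα : ∀ i, 0 ≤ α i)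
    (hS : ∀ n ∈ S, ∀ i, n i ∈ admDegree (α i)) :
    ∑ i, ∫ x, hermiteSumDeriv α S c i x * hermiteSumDeriv α S c i x ∂(monGauss α)
      = ∑ n ∈ S, c n ^ 2 * (∑ i, (n i : ℝ))
        * ∫ x, hermiteProd α n x * hermiteProd α n x ∂(monGauss α) := by
  rw [sum_integral_mul_hermiteSumDeriv hα hS hasTemperateGrowth_hermiteSum
    hasTemperateGrowth_hermiteSumDeriv hasLineDerivAt_hermiteSum]
  refine Finset.sum_congr rfl fun n hn => ?_
  rw [integral_hermiteSum_mul_hermiteProd hα hS (hS n hn), if_pos hn]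
  ring

/-- Only the degree one part of `w = L φ` can make `∫ w² - 2 ∫ |∇φ|²` negative. -/
lemma neg_sum_sq_le_integral_hermiteSum_sq_sub (hα : ∀ i, 0 ≤ α i)
    (hS : ∀ n ∈ S, ∀ i, n i ∈ admDegree (α i)) :
    -∑ j with α j = 0, (∫ x, x j * hermiteSum α S b x ∂(monGauss α)) ^ 2
      ≤ ∫ x, hermiteSum α S b x * hermiteSum α S b x ∂(monGauss α)
        - 2 * ∑ i, ∫ x, hermiteSumDeriv α S (solCoeff b) i x
            * hermiteSumDeriv α S (solCoeff b) i x ∂(monGauss α) := by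
  classical
  set h : (Fin N → ℕ) → ℝ := fun n => ∫ x, hermiteProd α n x * hermiteProd α n x ∂(monGauss α)
  have h0 : ∀ n, 0 ≤ h n := fun n => integral_nonneg fun x => mul_self_nonneg _
  have h1 : ∀ j, α j = 0 → h (Pi.single j 1) = 1 := fun j hj => by
    simpa only [h, hermiteProd_single] using integral_coord_mul_self hα hj
  have hc : ∀ j, α j = 0 → (∫ x, x j * hermiteSum α S b x ∂(monGauss α)) ^ 2
      = ∑ n ∈ S, if Pi.single j 1 = n then b n ^ 2 else 0 := by
    intro j hj
    have := integral_hermiteSum_mul_hermiteProd (c := b) hα hS (single_admissible hj)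
    rw [Finset.sum_ite_eq]
    simp only [mul_comm (hermiteSum α S b _), hermiteProd_single j] at this
    rw [this, integral_coord_mul_self hα hj]
    split_ifs <;> simp
  rw [integral_hermiteSum_sq hα hS, sum_integral_hermiteSumDeriv_sq hα hS,
    Finset.sum_congr rfl fun j hj => hc j (Finset.mem_filter.1 hj).2, Finset.sum_comm,
    Finset.mul_sum, ← Finset.sum_sub_distrib, ← Finset.sum_neg_distrib]
  refine Finset.sum_le_sum fun n hn => ?_
  have hsum : 0 ≤ ∑ j with α j = 0, if Pi.single j 1 = n then b n ^ 2 else 0 :=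
    Finset.sum_nonneg fun j _ => by split_ifs <;> positivity
  change _ ≤ b n ^ 2 * h n - 2 * (solCoeff b n ^ 2 * _ * h n)
  rcases eq_or_ne n 0 with rfl | hn0
  · have := mul_nonneg (sq_nonneg (b 0)) (h0 0)
    simpa using by linarith
  have hk := solCoeff_mul (b := b) hn0
  obtain ⟨j, hj⟩ := Function.ne_iff.1 hn0
  rcases le_or_gt 2 (∑ i, n i) with h2 | h2
  · have h2' : (2 : ℝ) ≤ ∑ i, (n i : ℝ) := by exact_mod_cast h2
    set d := ∑ i, (n i : ℝ)
    rw [← hk] at hsum ⊢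
    have : 0 ≤ solCoeff b n ^ 2 * d * h n * (d - 2) := by
      have := h0 n
      have : 0 ≤ d - 2 := by linarith
      positivity
    linarith
  · have hd : n = Pi.single j 1 := by
      rw [← Finset.add_sum_erase _ _ (Finset.mem_univ j)] at h2
      simp only [Pi.zero_apply] at hj
      have hz : ∑ i ∈ Finset.univ.erase j, n i = 0 := by omega
      ext i
      rcases eq_or_ne i j with rfl | hij
      · simp; omega
      · simpa [hij] using Finset.sum_eq_zero_iff.1 hz i (by simp [hij])
    have hαj : α j = 0 := by
      by_contra hne
      have := hS n hn j ((hα j).lt_of_ne' hne)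
      rw [hd] at this
      simp at this
    have hd1 : ∑ i, (n i : ℝ) = 1 := by
      rw [hd, ← Nat.cast_sum]
      simp
    rw [hd1, mul_one] at hk
    have hle : b n ^ 2 ≤ ∑ j with α j = 0, if Pi.single j 1 = n then b n ^ 2 else 0 := by
      refine le_trans ?_ (Finset.single_le_sum (fun j _ => by split_ifs <;> positivity)
        (Finset.mem_filter.2 ⟨Finset.mem_univ j, hαj⟩))
      simp [hd]
    have hn1 : h n = 1 := by rw [hd]; exact h1 j hαj
    rw [hd1, hk, hn1]
    linarith

end HermiteSum

section Main

variable {N : ℕ} {α : Fin N → ℝ}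

lemma integral_sub_sq {Ω : Type*} {mΩ : MeasurableSpace Ω} {μ : Measure Ω} {f g : Ω → ℝ}
    (hf : MemLp f 2 μ) (hg : MemLp g 2 μ) :
    ∫ x, (f x - g x) ^ 2 ∂μ
      = ∫ x, f x ^ 2 ∂μ - 2 * ∫ x, f x * g x ∂μ + ∫ x, g x * g x ∂μ := by
  have hfg : Integrable (fun x => f x * g x) μ := hf.integrable_mul hg
  have hgg : Integrable (fun x => g x * g x) μ := hg.integrable_mul hg
  have e : ∀ x, (f x - g x) ^ 2 = f x ^ 2 - 2 * (f x * g x) + g x * g x := fun x => by ring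
  simp only [e]
  rw [integral_add (by exact hf.integrable_sq.sub (hfg.const_mul 2)) hgg,
    integral_sub hf.integrable_sq (hfg.const_mul 2), integral_const_mul]

lemma sq_integral_le {Ω : Type*} {mΩ : MeasurableSpace Ω} {μ : Measure Ω} [IsProbabilityMeasure μ]
    {f : Ω → ℝ} (hf : MemLp f 2 μ) : (∫ x, f x ∂μ) ^ 2 ≤ ∫ x, f x ^ 2 ∂μ := by
  have h := ProbabilityTheory.variance_nonneg f μ
  rw [ProbabilityTheory.variance_eq_sub hf] at h
  simpa using h

lemma abs_integral_mul_le {Ω : Type*} {mΩ : MeasurableSpace Ω} {μ : Measure Ω} {f g : Ω → ℝ}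
    (hf : MemLp f 2 μ) (hg : MemLp g 2 μ) {δ : ℝ} (hδ : 0 < δ) (h : ∫ x, g x ^ 2 ∂μ ≤ δ ^ 2) :
    |∫ x, f x * g x ∂μ| ≤ δ * (∫ x, f x ^ 2 ∂μ + 1) := by
  have hf2 : 0 ≤ ∫ x, f x ^ 2 ∂μ := integral_nonneg fun x => sq_nonneg _
  calc |∫ x, f x * g x ∂μ| ≤ ∫ x, |f x * g x| ∂μ := abs_integral_le_integral_abs
    _ ≤ ∫ x, (δ * f x ^ 2 + δ⁻¹ * g x ^ 2) ∂μ := by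
      refine integral_mono (hf.integrable_mul hg).abs
        ((hf.integrable_sq.const_mul δ).add (hg.integrable_sq.const_mul δ⁻¹)) fun x => ?_
      have hexp : δ⁻¹ * ((δ * |f x| - |g x|) ^ 2) = δ * f x ^ 2 + δ⁻¹ * g x ^ 2
          - 2 * (|f x| * |g x|) := by
        rw [← sq_abs (f x), ← sq_abs (g x)]
        field_simp
        ring
      have : 0 ≤ δ⁻¹ * ((δ * |f x| - |g x|) ^ 2) := by positivity
      have : 0 ≤ |f x| * |g x| := by positivity
      simp only [abs_mul]
      linarith
    _ = δ * ∫ x, f x ^ 2 ∂μ + δ⁻¹ * ∫ x, g x ^ 2 ∂μ := by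
      rw [integral_add (hf.integrable_sq.const_mul δ) (hg.integrable_sq.const_mul δ⁻¹),
        integral_const_mul, integral_const_mul]
    _ ≤ δ * ∫ x, f x ^ 2 ∂μ + δ⁻¹ * δ ^ 2 := by gcongr
    _ = δ * (∫ x, f x ^ 2 ∂μ + 1) := by field_simp

lemma exists_approx_half_dirichlet_sub_variance (hα : ∀ i, 0 ≤ α i)
    {U : EuclideanSpace ℝ (Fin N) → ℝ} {U' : Fin N → EuclideanSpace ℝ (Fin N) → ℝ}
    (hU : U.HasTemperateGrowth) (hU' : ∀ i, (U' i).HasTemperateGrowth)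
    (hd : ∀ i x, HasLineDerivAt ℝ U (U' i x) x (EuclideanSpace.single i 1))
    (hm : ∫ x, U x ∂(monGauss α) = 0) {δ : ℝ} (hδ : 0 < δ) :
    ∃ p : Fin N → ℝ,
      (∀ j, |p j - ∫ x, U x * x j ∂(monGauss α)|
        ≤ δ * (∫ x, (x j - ∫ y, y j ∂(monGauss α)) ^ 2 ∂(monGauss α) + 1)) ∧
      1 / 2 * ∑ i, ((∫ x, U' i x ∂(monGauss α)) - 2 * p i) ^ 2 - ∑ j with α j = 0, p j ^ 2 - δ ^ 2
        ≤ 1 / 2 * ∑ i, ∫ x, U' i x ^ 2 ∂(monGauss α) - ∫ x, U x ^ 2 ∂(monGauss α) := by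
  have := isProbabilityMeasure_monGauss hα
  obtain ⟨S, b, hS, hb⟩ := exists_hermiteProd_approx hα (hU.memLp_monGauss hα) (pow_pos hδ 2)
  set μ := monGauss α
  set q := hermiteSumDeriv α S (solCoeff b) with hq
  set w := hermiteSum α S b with hw
  change ∫ x, (U x - w x) ^ 2 ∂μ < δ ^ 2 at hb
  have hqT : ∀ i, (q i).HasTemperateGrowth := fun i => hasTemperateGrowth_hermiteSumDeriv i
  have hwT : w.HasTemperateGrowth := hasTemperateGrowth_hermiteSum
  have hp : ∀ j, ∫ x, q j x ∂μ = ∫ x, (x j - ∫ y, y j ∂μ) * w x ∂μ := by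
    intro j
    have h := sum_integral_mul_solDeriv (b := b) hα hS
      (f := fun x => x j - ∫ y, y j ∂μ) (f' := fun i _ => if j = i then 1 else 0)
      ((hasTemperateGrowth_coord j).sub (Function.HasTemperateGrowth.const _))
      (fun i => Function.HasTemperateGrowth.const _) (fun i x => hasLineDerivAt_coord j i _ x)
      (by
        rw [integral_sub ((hasTemperateGrowth_coord j).integrable_monGauss hα)
          (integrable_const _)]
        simp [μ])
    rw [← h, Finset.sum_eq_single j]
    · simp [q, μ]
    · intro i _ hi
      simp [hi.symm]
    · simp
  refine ⟨fun j => ∫ x, q j x ∂μ, fun j => ?_, ?_⟩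
  · have hxT : (fun x : EuclideanSpace ℝ (Fin N) => x j - ∫ y, y j ∂μ).HasTemperateGrowth :=
      (hasTemperateGrowth_coord j).sub (Function.HasTemperateGrowth.const _)
    have h1 : ∫ x, (x j - ∫ y, y j ∂μ) * w x ∂μ - ∫ x, U x * x j ∂μ
        = -∫ x, (x j - ∫ y, y j ∂μ) * (U x - w x) ∂μ := by
      have hxU : Integrable (fun x => U x * x j) μ :=
        (hU.mul (hasTemperateGrowth_coord j)).integrable_monGauss hα
      have e : ∀ x : EuclideanSpace ℝ (Fin N), (x j - ∫ y, y j ∂μ) * (U x - w x)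
          = U x * x j - (∫ y, y j ∂μ) * U x - (x j - ∫ y, y j ∂μ) * w x := fun x => by ring
      simp only [e]
      rw [integral_sub (by exact hxU.sub ((hU.integrable_monGauss hα).const_mul _))
          (by exact (hxT.mul hwT).integrable_monGauss hα),
        integral_sub hxU ((hU.integrable_monGauss hα).const_mul _), integral_const_mul, hm]
      ring
    simp only [hp, h1, abs_neg]
    exact abs_integral_mul_le (hxT.memLp_monGauss hα) ((hU.sub hwT).memLp_monGauss hα) hδ hb.le
  · have hp0 : ∑ j with α j = 0, (∫ x, q j x ∂μ) ^ 2
        = ∑ j with α j = 0, (∫ x, x j * w x ∂μ) ^ 2 := by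
      refine Finset.sum_congr rfl fun j hj => ?_
      rw [hp, integral_coord_eq_zero hα (Finset.mem_filter.1 hj).2]
      simp
    have hneg := neg_sum_sq_le_integral_hermiteSum_sq_sub (b := b) hα hS
    rw [← hw, ← hq, ← hp0] at hneg
    have hUw := sum_integral_mul_solDeriv (b := b) hα hS hU hU' hd hm
    rw [← hw, ← hq] at hUw
    have hbexp := integral_sub_sq (hU.memLp_monGauss hα) (hwT.memLp_monGauss hα)
    have hjensen : ∀ i, ((∫ x, U' i x ∂μ) - 2 * ∫ x, q i x ∂μ) ^ 2
        ≤ ∫ x, U' i x ^ 2 ∂μ - 4 * ∫ x, U' i x * q i x ∂μ + 4 * ∫ x, q i x * q i x ∂μ := by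
      intro i
      have h2q : (fun x => 2 * q i x).HasTemperateGrowth :=
        (Function.HasTemperateGrowth.const 2).mul (hqT i)
      have h := sq_integral_le (((hU' i).sub h2q).memLp_monGauss hα)
      simp only [Pi.sub_apply] at h
      rw [integral_sub_sq ((hU' i).memLp_monGauss hα) (h2q.memLp_monGauss hα),
        integral_sub ((hU' i).integrable_monGauss hα) (h2q.integrable_monGauss hα),
        integral_const_mul] at h
      have e1 : ∀ x, U' i x * (2 * q i x) = 2 * (U' i x * q i x) := fun x => by ring
      have e2 : ∀ x, 2 * q i x * (2 * q i x) = 4 * (q i x * q i x) := fun x => by ring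
      simp only [e1, e2, integral_const_mul] at h
      linarith
    have hsum := Finset.sum_le_sum fun i (_ : i ∈ Finset.univ) => hjensen i
    rw [Finset.sum_add_distrib, Finset.sum_sub_distrib, ← Finset.mul_sum, ← Finset.mul_sum]
      at hsum
    linarith

lemma half_dirichlet_sub_variance_ge (hα : ∀ i, 0 ≤ α i)
    {U : EuclideanSpace ℝ (Fin N) → ℝ} {U' : Fin N → EuclideanSpace ℝ (Fin N) → ℝ}
    (hU : U.HasTemperateGrowth) (hU' : ∀ i, (U' i).HasTemperateGrowth)
    (hd : ∀ i x, HasLineDerivAt ℝ U (U' i x) x (EuclideanSpace.single i 1))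
    (hm : ∫ x, U x ∂(monGauss α) = 0) :
    1 / 2 * ∑ i, ((∫ x, U' i x ∂(monGauss α)) - 2 * ∫ x, U x * x i ∂(monGauss α)) ^ 2
        - ∑ j with α j = 0, (∫ x, U x * x j ∂(monGauss α)) ^ 2
      ≤ 1 / 2 * ∑ i, ∫ x, U' i x ^ 2 ∂(monGauss α) - ∫ x, U x ^ 2 ∂(monGauss α) := by
  have hδ : ∀ k : ℕ, (0 : ℝ) < 1 / (k + 1) := fun k => by positivity
  choose p hp hle using fun k => exists_approx_half_dirichlet_sub_variance hα hU hU' hd hm (hδ k)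
  have h0 := tendsto_one_div_add_atTop_nhds_zero_nat (𝕜 := ℝ)
  have hlim : ∀ j, Filter.Tendsto (fun k => p k j) Filter.atTop
      (nhds (∫ x, U x * x j ∂(monGauss α))) := fun j => by
    rw [tendsto_iff_norm_sub_tendsto_zero]
    exact squeeze_zero (fun k => norm_nonneg _) (fun k => hp k j) (by simpa using h0.mul_const _)
  have hL := (((tendsto_finsetSum Finset.univ fun i _ => (((hlim i).const_mul 2).const_sub
    (∫ x, U' i x ∂(monGauss α))).pow 2).const_mul (1 / 2)).sub (tendsto_finsetSum
      (Finset.univ.filter fun j => α j = 0) fun j _ => (hlim j).pow 2)).sub (h0.pow 2)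
  refine le_of_tendsto (by simpa using hL) (Filter.Eventually.of_forall hle)

lemma norm_gradient_sq (f : EuclideanSpace ℝ (Fin N) → ℝ) (x : EuclideanSpace ℝ (Fin N)) :
    ‖gradient f x‖ ^ 2 = ∑ i, fderiv ℝ f x (EuclideanSpace.single i 1) ^ 2 := by
  rw [EuclideanSpace.norm_sq_eq]
  refine Finset.sum_congr rfl fun i _ => ?_
  rw [Real.norm_eq_abs, sq_abs]
  congr 1
  have : inner ℝ (gradient f x) (EuclideanSpace.single i 1)
      = fderiv ℝ f x (EuclideanSpace.single i 1) := by
    simp [gradient]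
  rw [← this, EuclideanSpace.inner_single_right]
  simp

lemma fderiv_sub_sum_coord {f : EuclideanSpace ℝ (Fin N) → ℝ} {x : EuclideanSpace ℝ (Fin N)}
    (hf : DifferentiableAt ℝ f x) (v : Fin N → ℝ) (i : Fin N) :
    fderiv ℝ (fun y => f y - ∑ j, v j * y j) x (EuclideanSpace.single i 1)
      = fderiv ℝ f x (EuclideanSpace.single i 1) - v i := by
  classical
  have h : HasFDerivAt (fun y : EuclideanSpace ℝ (Fin N) => ∑ j, v j * y j)
      (∑ j, v j • (EuclideanSpace.proj j : EuclideanSpace ℝ (Fin N) →L[ℝ] ℝ)) x :=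
    HasFDerivAt.fun_sum fun j _ =>
      (EuclideanSpace.proj j : EuclideanSpace ℝ (Fin N) →L[ℝ] ℝ).hasFDerivAt.const_mul (v j)
  rw [(hf.hasFDerivAt.fun_sub h).fderiv]
  simp

end Main

/-- Improved Poincaré inequality with monomial Gaussian weight:
`∫|∇u|² dμ_A − ∫|u − ∫u dμ_A|² dμ_A
  ≥ (1/2) ∫ |∇[u − (∫ (u − ∫u dμ_A) x dμ_A) · x]|² dμ_A`. -/
theorem improved_poincare_monomial_gaussian {N : ℕ} (hN : 1 ≤ N) (α : Fin N → ℝ)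
    (hα : ∀ i, 0 ≤ α i) (u : EuclideanSpace ℝ (Fin N) → ℝ) (hu : NstarClass α u) :
    let μ := monGauss α
    let m := ∫ y, u y ∂μ
    let v : Fin N → ℝ := fun j => ∫ z, (u z - m) * z j ∂μ
    (∫ x, ‖gradient u x‖ ^ 2 ∂μ) - (∫ x, (u x - m) ^ 2 ∂μ) ≥
      (1 / 2) * ∫ x, ‖gradient (fun y => u y - ∑ j, v j * y j) x‖ ^ 2 ∂μ := by
  intro μ m v
  have := isProbabilityMeasure_monGauss hα
  set D : Fin N → EuclideanSpace ℝ (Fin N) → ℝ :=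
    fun i x => fderiv ℝ u x (EuclideanSpace.single i 1)
  have hu1 : Differentiable ℝ u := hu.1.differentiable (by simp)
  have huT : u.HasTemperateGrowth := hu.2.1.hasTemperateGrowth hu.1
  have hDT : ∀ i, (D i).HasTemperateGrowth := fun i =>
    (hu.2.1.fderiv_apply ℝ _).hasTemperateGrowth
      ((hu.1.fderiv_right (by simp)).clm_apply contDiff_const)
  have hUT : (fun x => u x - m).HasTemperateGrowth :=
    huT.sub (Function.HasTemperateGrowth.const m)
  have hd : ∀ i x, HasLineDerivAt ℝ (fun x => u x - m) (D i x) x (EuclideanSpace.single i 1) :=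
    fun i x => ((hu1 x).hasFDerivAt.sub_const m).hasLineDerivAt _
  have hm : ∫ x, (u x - m) ∂μ = 0 := by
    rw [integral_sub (huT.integrable_monGauss hα) (integrable_const _)]
    simp [m, μ]
  have hmain := half_dirichlet_sub_variance_ge hα hUT hDT hd hm
  have hDsq : ∀ i, Integrable (fun x => D i x ^ 2) μ := fun i =>
    ((hDT i).memLp_monGauss hα).integrable_sq
  have hDvsq : ∀ i, Integrable (fun x => (D i x - v i) ^ 2) μ := fun i =>
    (((hDT i).sub (Function.HasTemperateGrowth.const (v i))).memLp_monGauss hα).integrable_sq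
  have hshift : ∀ i, ∫ x, (D i x - v i) ^ 2 ∂μ
      = ∫ x, D i x ^ 2 ∂μ - 2 * v i * ∫ x, D i x ∂μ + v i ^ 2 := fun i => by
    rw [integral_sub_sq ((hDT i).memLp_monGauss hα) (memLp_const _), integral_mul_const]
    simp only [integral_const, probReal_univ, μ, one_smul]
    ring
  simp only [norm_gradient_sq, fderiv_sub_sum_coord (hu1 _)]
  rw [integral_finsetSum _ fun i _ => hDsq i, integral_finsetSum _ fun i _ => hDvsq i]
  change _ - _ ≥ 1 / 2 * ∑ i, ∫ x, (D i x - v i) ^ 2 ∂μ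
  have hcoord : ∀ i, 1 / 2 * ∫ x, (D i x - v i) ^ 2 ∂μ
      ≤ 1 / 2 * ∫ x, D i x ^ 2 ∂μ + (1 / 2 * (∫ x, D i x ∂μ - 2 * v i) ^ 2
        - if α i = 0 then v i ^ 2 else 0) := by
    intro i
    rw [hshift]
    split_ifs with hi
    · have : v i = ∫ x, D i x ∂μ := integral_mul_coord hα hi hUT (hDT i) (hd i)
      rw [← this]
      nlinarith
    · nlinarith [sq_nonneg (∫ x, D i x ∂μ - v i), sq_nonneg (v i)]
  have hsum := Finset.sum_le_sum fun i (_ : i ∈ Finset.univ) => hcoord i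
  rw [Finset.sum_add_distrib, Finset.sum_sub_distrib, ← Finset.mul_sum, ← Finset.mul_sum,
    ← Finset.mul_sum, ← Finset.sum_filter] at hsum
  change 1 / 2 * ∑ i, (∫ x, D i x ∂μ - 2 * v i) ^ 2 - ∑ j with α j = 0, v j ^ 2
    ≤ 1 / 2 * ∑ i, ∫ x, D i x ^ 2 ∂μ - ∫ x, (u x - m) ^ 2 ∂μ at hmain
  linarith
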